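/- arXiv:2402.10653 — 2 statements merged into one kernel-verified Lean document; each statement's English description precedes it below -/
import Mathlib

section
/- Under the standing curve hypotheses, every nonempty open proper subset Ω of H¹ satisfies Ω = ⋃{B : B∈E}, where E := { B_{t_l}(x,1) : x∈Ω, l∈ℤ, A₀ < ρ_l(x,∂Ω) < A₁ } and ρ_l(x,∂Ω):=inf_{y∈∂Ω}ρ_l(x,y); moreover, if in addition Ω has finite Lebesgue measure, then there exists a countable pairwise disjoint family of balls B_{t_{l_i}}(x_i,1)∈E such that Ω = ⋃_i B_{t_{l_i}}(x_i, 6C₀). -/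
open MeasureTheory Real Set
open scoped ENNReal NNReal

noncomputable section

/-- The underlying space of the Heisenberg group `H¹ ≅ ℝ³`. -/
abbrev H3 : Type := Fin 3 → ℝ

/-- Heisenberg group multiplication. -/
def hmul (x y : H3) : H3 :=
  ![x 0 + y 0, x 1 + y 1, x 2 + y 2 + (1/2) * (x 0 * y 1 - x 1 * y 0)]

/-- Heisenberg group inverse. -/
def hinv (x : H3) : H3 := -x

/-- Second derivative. -/
def d2 (f : ℝ → ℝ) : ℝ → ℝ := deriv (deriv f)

/-- Third derivative. -/
def d3 (f : ℝ → ℝ) : ℝ → ℝ := deriv (deriv (deriv f))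

/-- `h₂(t) = t α'(t) - α(t)`. -/
def h₂ (α : ℝ → ℝ) (t : ℝ) : ℝ := t * deriv α t - α t

/-- `β̄(t) = β(t) - (1/2)∫₀ᵗ h₂`. -/
def βbar (α β : ℝ → ℝ) (t : ℝ) : ℝ := β t - (1/2) * ∫ s in (0:ℝ)..t, h₂ α s

/-- `h̄₃(t) = det [[t,α,β̄],[1,α',β̄'],[0,α'',β̄'']] / α''(t)`. -/
def hbar₃ (α β : ℝ → ℝ) (t : ℝ) : ℝ :=
  Matrix.det !![t, α t, βbar α β t;
                1, deriv α t, deriv (βbar α β) t;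
                0, d2 α t, d2 (βbar α β) t] / d2 α t

/-- `h̄_β(t) = t β̄'(t) - β̄(t)`. -/
def hβbar (α β : ℝ → ℝ) (t : ℝ) : ℝ := t * deriv (βbar α β) t - βbar α β t

/-- The standing curve hypotheses of the paper. -/
structure Standing (α β : ℝ → ℝ) : Prop where
  alpha_odd : ∀ t, α (-t) = -α t
  beta_odd : ∀ t, β (-t) = -β t
  alpha_cont : Continuous α
  beta_cont : Continuous β
  alpha_c3 : ContDiffOn ℝ 3 α (Set.Ioi 0)
  beta_c3 : ContDiffOn ℝ 3 β (Set.Ioi 0)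
  alpha_deriv0 : deriv α 0 = 0
  d2α_pos : ∀ t, 0 < t → 0 < d2 α t
  Dbar3_pos : ∀ t, 0 < t →
    0 < d2 α t * d3 (βbar α β) t - d3 α t * d2 (βbar α β) t
  Dhat3_pos : ∀ t, 0 < t →
    0 < d2 α t * (d3 (βbar α β) t + 2 * d2 α t) - d3 α t * (d2 (βbar α β) t + deriv α t)
  Ddoublehat3_pos : ∀ t, 0 < t →
    0 < d2 α t * (d3 (βbar α β) t - d2 α t) - d3 α t * (d2 (βbar α β) t - deriv α t)
  Dtriplehat3_pos : ∀ t, 0 < t →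
    0 < d2 α t * (d3 (βbar α β) t - d2 α t) - d3 α t * (d2 (βbar α β) t - deriv α t + α t / t)
  growth : ∃ c, 0 < c ∧ ∀ t, 0 < t →
    c * (h₂ α t / t) ≤ deriv (h₂ α) t ∧
    c * (hbar₃ α β t / t) ≤ deriv (hbar₃ α β) t ∧
    c * (∫ s in (0:ℝ)..t, h₂ α s) ≤ hbar₃ α β t
/-- The matrix `Ã(t)`. -/
def Atil (α β : ℝ → ℝ) (t : ℝ) : Matrix (Fin 3) (Fin 3) ℝ :=
  !![t, 0, 0;
     α t, h₂ α t, 0;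
     βbar α β t, hβbar α β t, t * h₂ α t + hbar₃ α β t]

/-- `t_j = 2^{-j}`. -/
def tj (j : ℕ) : ℝ := ((2:ℝ) ^ j)⁻¹

/-- `S_j = det Ã_j`. -/
def Sdet (α β : ℝ → ℝ) (j : ℕ) : ℝ := (Atil α β (tj j)).det

/-- `ξ_t = (1/2) t h₂(t) / (t h₂(t) + h̄₃(t))`. -/
def ξc (α β : ℝ → ℝ) (t : ℝ) : ℝ := (1/2) * (t * h₂ α t) / (t * h₂ α t + hbar₃ α β t)

/-- `ξ_j`. -/
def ξj (α β : ℝ → ℝ) (j : ℕ) : ℝ := ξc α β (tj j)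

/-- Frobenius norm of a `3 × 3` real matrix. -/
def frob (M : Matrix (Fin 3) (Fin 3) ℝ) : ℝ := Real.sqrt (∑ i, ∑ k, (M i k) ^ 2)
/-- The ball `B_t(x,r) = { x · (Ã(t)z) : z ∈ [−r,r]×[−r,r]×[−r²,r²] }`. -/
def ballH (α β : ℝ → ℝ) (t : ℝ) (x : H3) (r : ℝ) : Set H3 :=
  {w | ∃ z : Fin 3 → ℝ, |z 0| ≤ r ∧ |z 1| ≤ r ∧ |z 2| ≤ r ^ 2 ∧
        w = hmul x ((Atil α β t).mulVec z)}

/-- `ρ_t(x,y) = sup { r > 0 : y ∉ B_t(x,r) }`. -/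
def rhoH (α β : ℝ → ℝ) (t : ℝ) (x y : H3) : ℝ :=
  sSup {r : ℝ | 0 < r ∧ y ∉ ballH α β t x r}

/-- `ρ_t(x,Ω) = inf_{y ∈ Ω} ρ_t(x,y)`. -/
def rhoHSet (α β : ℝ → ℝ) (t : ℝ) (x : H3) (Ω : Set H3) : ℝ :=
  sInf ((rhoH α β t x) '' Ω)


section aux
variable {α β : ℝ → ℝ}

lemma aux_h2_pos (hst : Standing α β) {t : ℝ} (ht : 0 < t) : 0 < h₂ α t := by
  have hmono : StrictMonoOn (deriv α) (Ioi 0) := by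
    apply strictMonoOn_of_deriv_pos (convex_Ioi 0)
    · intro x hx
      have h := hst.d2α_pos x hx
      exact (differentiableAt_of_deriv_ne_zero (ne_of_gt h)).continuousAt.continuousWithinAt
    · intro x hx
      rw [interior_Ioi] at hx
      exact hst.d2α_pos x hx
  have h0 : α 0 = 0 := by
    have := hst.alpha_odd 0
    simp at this
    linarith
  obtain ⟨c, hc, hc'⟩ := exists_deriv_eq_slope α ht hst.alpha_cont.continuousOn (by
    intro x hx
    exact ((hst.alpha_c3.differentiableOn (by norm_num)).differentiableAt
      (Ioi_mem_nhds hx.1)).differentiableWithinAt)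
  have h1 := hmono (show c ∈ Ioi (0:ℝ) from hc.1) (show t ∈ Ioi (0:ℝ) from ht) hc.2
  rw [hc', h0, sub_zero, sub_zero, div_lt_iff₀ ht] at h1
  unfold h₂
  linarith

lemma aux_h2_mono (hst : Standing α β) {t s : ℝ} (ht : 0 < t) (hts : t ≤ s) :
    h₂ α t ≤ h₂ α s := by
  obtain ⟨c, hc, hg⟩ := hst.growth
  have hp : ∀ x, 0 < x → 0 < deriv (h₂ α) x := fun x hx =>
    lt_of_lt_of_le (mul_pos hc (div_pos (aux_h2_pos hst hx) hx)) (hg x hx).1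
  have hmono : StrictMonoOn (h₂ α) (Ioi 0) := by
    apply strictMonoOn_of_deriv_pos (convex_Ioi 0)
    · intro x hx
      exact (differentiableAt_of_deriv_ne_zero (ne_of_gt (hp x hx))).continuousAt.continuousWithinAt
    · intro x hx
      rw [interior_Ioi] at hx
      exact hp x hx
  exact hmono.monotoneOn ht (lt_of_lt_of_le ht hts) hts

lemma aux_h3_pos (hst : Standing α β) {t : ℝ} (ht : 0 < t) : 0 < hbar₃ α β t := by
  obtain ⟨c, hc, hg⟩ := hst.growth
  refine lt_of_lt_of_le (mul_pos hc ?_) (hg t ht).2.2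
  have h0 : α 0 = 0 := by
    have := hst.alpha_odd 0
    simp at this
    linarith
  have h20 : h₂ α 0 = 0 := by simp [h₂, h0]
  apply intervalIntegral.intervalIntegral_pos_of_pos_on
  · apply MonotoneOn.intervalIntegrable
    rw [uIcc_of_le ht.le]
    intro x hx y hy hxy
    rcases eq_or_lt_of_le hx.1 with h | h
    · rw [← h, h20]
      rcases eq_or_lt_of_le hy.1 with h' | h'
      · rw [← h', h20]
      · exact (aux_h2_pos hst h').le
    · exact aux_h2_mono hst h hxy
  · intro x hx
    exact aux_h2_pos hst hx.1
  · exact ht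

lemma aux_h3_mono (hst : Standing α β) {t s : ℝ} (ht : 0 < t) (hts : t ≤ s) :
    hbar₃ α β t ≤ hbar₃ α β s := by
  obtain ⟨c, hc, hg⟩ := hst.growth
  have hp : ∀ x, 0 < x → 0 < deriv (hbar₃ α β) x := fun x hx =>
    lt_of_lt_of_le (mul_pos hc (div_pos (aux_h3_pos hst hx) hx)) (hg x hx).2.1
  have hmono : StrictMonoOn (hbar₃ α β) (Ioi 0) := by
    apply strictMonoOn_of_deriv_pos (convex_Ioi 0)
    · intro x hx
      exact (differentiableAt_of_deriv_ne_zero (ne_of_gt (hp x hx))).continuousAt.continuousWithinAt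
    · intro x hx
      rw [interior_Ioi] at hx
      exact hp x hx
  exact hmono.monotoneOn ht (lt_of_lt_of_le ht hts) hts

lemma aux_det (t : ℝ) : (Atil α β t).det = t * h₂ α t * (t * h₂ α t + hbar₃ α β t) := by
  simp [Atil, Matrix.det_fin_three]

lemma aux_det_pos (hst : Standing α β) {t : ℝ} (ht : 0 < t) : 0 < (Atil α β t).det := by
  rw [aux_det]
  have := aux_h2_pos hst ht
  have := aux_h3_pos hst ht
  positivity

lemma aux_mul_inv (hst : Standing α β) {t : ℝ} (ht : 0 < t) (M : Matrix (Fin 3) (Fin 3) ℝ) :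
    Atil α β t * ((Atil α β t)⁻¹ * M) = M :=
  Matrix.mul_nonsing_inv_cancel_left _ _ (isUnit_iff_ne_zero.2 (aux_det_pos hst ht).ne')

lemma aux_coord (hst : Standing α β) {t : ℝ} (ht : 0 < t) (w : H3) :
    ∃ z : H3, w = (Atil α β t).mulVec z := by
  refine ⟨(Atil α β t)⁻¹.mulVec w, ?_⟩
  rw [Matrix.mulVec_mulVec, Matrix.mul_nonsing_inv _
    (isUnit_iff_ne_zero.2 (aux_det_pos hst ht).ne'), Matrix.one_mulVec]

lemma aux_hmul_inv (x y : H3) : y = hmul x (hmul (-x) y) := by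
  ext i
  fin_cases i <;> simp [hmul]
  ring

lemma aux_coord' (hst : Standing α β) {t : ℝ} (ht : 0 < t) (x y : H3) :
    ∃ z : H3, y = hmul x ((Atil α β t).mulVec z) := by
  obtain ⟨z, hz⟩ := aux_coord hst ht (hmul (-x) y)
  exact ⟨z, by rw [← hz]; exact aux_hmul_inv x y⟩

lemma aux_entry (M : Matrix (Fin 3) (Fin 3) ℝ) {F : ℝ} (h : frob M ≤ F) (i j : Fin 3) :
    |M i j| ≤ F := by
  refine le_trans ?_ h
  apply Real.abs_le_sqrt
  have h1 : (M i j)^2 ≤ ∑ k, (M i k)^2 :=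
    Finset.single_le_sum (f := fun k => (M i k)^2) (fun k _ => sq_nonneg _) (Finset.mem_univ j)
  have h2 : ∑ k, (M i k)^2 ≤ ∑ i, ∑ k, (M i k)^2 :=
    Finset.single_le_sum (f := fun i => ∑ k, (M i k)^2)
      (fun k _ => Finset.sum_nonneg fun _ _ => sq_nonneg _) (Finset.mem_univ i)
  exact h1.trans h2

lemma aux_frob_mulVec (M : Matrix (Fin 3) (Fin 3) ℝ) {F K : ℝ} (h : frob M ≤ F) (z : H3)
    (hz : ∀ i, |z i| ≤ K) (i : Fin 3) : |M.mulVec z i| ≤ 2 * F * K := by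
  have hF : 0 ≤ F := (Real.sqrt_nonneg _).trans h
  have hK : 0 ≤ K := (abs_nonneg _).trans (hz 0)
  have h2 : ∑ k, (M i k)^2 ≤ F^2 := by
    have h2 : ∑ k, (M i k)^2 ≤ ∑ i, ∑ k, (M i k)^2 :=
      Finset.single_le_sum (f := fun i => ∑ k, (M i k)^2)
        (fun k _ => Finset.sum_nonneg fun _ _ => sq_nonneg _) (Finset.mem_univ i)
    refine h2.trans ?_
    unfold frob at h
    exact (Real.sqrt_le_left hF).1 h
  have h3 : |M i 0| + |M i 1| + |M i 2| ≤ 2 * F := by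
    apply abs_le_of_sq_le_sq' _ (by positivity) |>.2
    rw [Fin.sum_univ_three, ← sq_abs (M i 0), ← sq_abs (M i 1), ← sq_abs (M i 2)] at h2
    nlinarith [sq_nonneg (|M i 0| - |M i 1|), sq_nonneg (|M i 0| - |M i 2|),
      sq_nonneg (|M i 1| - |M i 2|), sq_nonneg F]
  have h4 : M.mulVec z i = M i 0 * z 0 + M i 1 * z 1 + M i 2 * z 2 := by
    simp [Matrix.mulVec, dotProduct, Fin.sum_univ_three]
  rw [h4]
  calc |M i 0 * z 0 + M i 1 * z 1 + M i 2 * z 2|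
      ≤ |M i 0| * |z 0| + |M i 1| * |z 1| + |M i 2| * |z 2| := by
        rw [← abs_mul, ← abs_mul, ← abs_mul]; exact abs_add_three _ _ _
    _ ≤ |M i 0| * K + |M i 1| * K + |M i 2| * K := by
        gcongr <;> apply hz
    _ = (|M i 0| + |M i 1| + |M i 2|) * K := by ring
    _ ≤ 2 * F * K := by gcongr

lemma aux_change (hst : Standing α β) {C₀ ε₀ : ℝ}
    (hfrob : ∀ t s : ℝ, 0 < t → t ≤ s →
        frob ((Atil α β s)⁻¹ * Atil α β t) ≤ C₀ * (t/s) ^ ε₀) {t s K : ℝ} (ht : 0 < t) (hts : t ≤ s)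
    (z : H3) (hz : ∀ i, |z i| ≤ K) :
    ∃ u : H3, (Atil α β t).mulVec z = (Atil α β s).mulVec u ∧
      ∀ i, |u i| ≤ 2 * (C₀ * (t/s) ^ ε₀) * K := by
  refine ⟨((Atil α β s)⁻¹ * Atil α β t).mulVec z, ?_, ?_⟩
  · rw [Matrix.mulVec_mulVec, aux_mul_inv hst (ht.trans_le hts)]
  · exact aux_frob_mulVec _ (hfrob t s ht hts) z hz

set_option maxHeartbeats 2000000 in
lemma aux_back (hst : Standing α β) {C₀ ε₀ c₀ : ℝ} (hC₀ : 1 ≤ C₀) (hc₀ : 1 ≤ c₀) (hε₀ : 0 < ε₀)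
    (hfrob : ∀ t s : ℝ, 0 < t → t ≤ s →
        frob ((Atil α β s)⁻¹ * Atil α β t) ≤ C₀ * (t/s) ^ ε₀) {t s K : ℝ} (ht : 0 < t) (hts : t ≤ s)
    (hr : s * h₂ α s * hbar₃ α β s ≤ c₀ * (t * h₂ α t * hbar₃ α β t))
    (z : H3) (hz : ∀ i, |z i| ≤ K) :
    ∃ u : H3, (Atil α β s).mulVec z = (Atil α β t).mulVec u ∧
      ∀ i, |u i| ≤ 4 * C₀ ^ 2 * c₀ ^ 2 * K := by
  have hs := ht.trans_le hts
  obtain ⟨u, hu⟩ := aux_coord hst ht ((Atil α β s).mulVec z)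
  refine ⟨u, hu, ?_⟩
  have hK : 0 ≤ K := (abs_nonneg _).trans (hz 0)
  set P := (Atil α β s)⁻¹ * Atil α β t with hP
  have hF : frob P ≤ C₀ := by
    refine (hfrob t s ht hts).trans ?_
    have : (t/s)^ε₀ ≤ 1 := Real.rpow_le_one (by positivity) (by rw [div_le_one hs]; exact hts) hε₀.le
    nlinarith
  have hPe := aux_entry P hF
  have hmul : Atil α β s * P = Atil α β t := aux_mul_inv hst hs _
  have hPu : P.mulVec u = z := by
    rw [hP, ← Matrix.mulVec_mulVec, ← hu, Matrix.mulVec_mulVec, Matrix.nonsing_inv_mul _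
      (isUnit_iff_ne_zero.2 (aux_det_pos hst hs).ne'), Matrix.one_mulVec]
  have e : ∀ i j, (Atil α β s * P) i j = Atil α β t i j := fun i j => by rw [hmul]
  have h2t := aux_h2_pos hst ht
  have h3t := aux_h3_pos hst ht
  have h2m := aux_h2_mono hst ht hts
  have h3m := aux_h3_mono hst ht hts
  have h2s := aux_h2_pos hst hs
  have h3s := aux_h3_pos hst hs
  have e00 := e 0 0
  have e01 := e 0 1
  have e02 := e 0 2
  have e11 := e 1 1
  have e12 := e 1 2
  have e22 := e 2 2
  have f0 := congrFun hPu 0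
  have f1 := congrFun hPu 1
  have f2 := congrFun hPu 2
  simp [Atil, Matrix.mul_apply, Fin.sum_univ_three] at e00 e01 e02 e11 e12 e22
  simp [Matrix.mulVec, dotProduct, Fin.sum_univ_three] at f0 f1 f2
  have p01 : P 0 1 = 0 := by rcases e01 with h | h; linarith; exact h
  have p02 : P 0 2 = 0 := by rcases e02 with h | h; linarith; exact h
  rw [p01] at e11
  rw [p02] at e12
  have p12 : P 1 2 = 0 := by
    rw [mul_zero, zero_add] at e12
    rcases mul_eq_zero.1 e12 with h | h; linarith; exact h
  rw [p02, p12] at e22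
  rw [p01, p02] at f0
  rw [p12] at f1
  set p0 := P 0 0
  set p1 := P 1 1
  set p2 := P 2 2
  have p0p : 0 < p0 := by by_contra h; push Not at h; nlinarith
  have p0l : p0 ≤ 1 := by by_contra h; push Not at h; nlinarith
  have p1p : 0 < p1 := by by_contra h; push Not at h; nlinarith
  have p1l : p1 ≤ 1 := by by_contra h; push Not at h; nlinarith
  generalize h₂ α t = a at *
  generalize h₂ α s = A at *
  generalize hbar₃ α β t = b at *
  generalize hbar₃ α β s = B at *
  have hta : t * a ≤ s * A := by gcongr
  have q1 : s * A ≤ c₀ * (t * a) := by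
    have : s * A * b ≤ c₀ * (t * a) * b := by
      calc s * A * b ≤ s * A * B := by gcongr
        _ ≤ _ := by linarith
    exact le_of_mul_le_mul_right this h3t
  have q2 : B ≤ c₀ * b := by
    have : (s * A) * B ≤ (s * A) * (c₀ * b) := by
      calc s * A * B ≤ (t * a) * (c₀ * b) := by linarith
        _ ≤ _ := by gcongr
    exact le_of_mul_le_mul_left this (by positivity)
  have r01 : 1 ≤ c₀ * (p0 * p1) := by
    have : t * a = (s * A) * (p0 * p1) := by rw [← e00]; have : a = A * p1 := by linarith
                                             rw [this]; ring
    rw [this] at q1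
    have : (s * A) * 1 ≤ (s * A) * (c₀ * (p0 * p1)) := by linarith
    exact le_of_mul_le_mul_left this (by positivity)
  have r2 : 1 ≤ c₀ * p2 := by
    have h : t * a + b = (s * A + B) * p2 := by linarith
    have : (s * A + B) * 1 ≤ (s * A + B) * (c₀ * p2) := by
      calc (s * A + B) * 1 ≤ c₀ * (t * a + b) := by linarith
        _ = _ := by rw [h]; ring
    exact le_of_mul_le_mul_left this (by positivity)
  have r0 : 1 ≤ c₀ * p0 := by nlinarith
  have hz0 := hz 0
  have hz1 := hz 1
  have hz2 := hz 2
  have b0 : |u 0| ≤ c₀ * K := by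
    have : u 0 = u 0 := rfl
    calc |u 0| = 1 * |u 0| := by ring
      _ ≤ (c₀ * p0) * |u 0| := by gcongr
      _ = c₀ * |z 0| := by rw [← f0, ← abs_of_pos p0p, mul_assoc, ← abs_mul, abs_of_pos p0p]; simp
      _ ≤ _ := by gcongr
  have b1 : |u 1| ≤ c₀ * (2 * C₀ * K) := by
    have h1 : (p0 * p1) * u 1 = p0 * z 1 - P 1 0 * z 0 := by rw [← f1, ← f0]; ring
    have h2 : |p0 * z 1 - P 1 0 * z 0| ≤ 1 * K + C₀ * K := by
      refine (abs_sub _ _).trans ?_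
      rw [abs_mul, abs_mul, abs_of_pos p0p]
      have := hPe 1 0
      gcongr
    calc |u 1| = 1 * |u 1| := by ring
      _ ≤ (c₀ * (p0 * p1)) * |u 1| := by gcongr
      _ = c₀ * |(p0 * p1) * u 1| := by rw [abs_mul, abs_of_pos (mul_pos p0p p1p)]; ring
      _ ≤ _ := by rw [h1]; gcongr; nlinarith
  have b2 : |u 2| ≤ c₀ ^ 2 * (4 * C₀ ^ 2 * K) := by
    have p2p : 0 < p2 := by by_contra h; push Not at h; nlinarith
    have h1 : (p0 * p1 * p2) * u 2 = (p0 * p1) * z 2 - P 2 0 * (p1 * z 0)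
        - P 2 1 * (p0 * z 1) + P 2 1 * (P 1 0 * z 0) := by
      rw [← f2, ← f1, ← f0]; ring
    have h2 : |(p0 * p1) * z 2 - P 2 0 * (p1 * z 0)
        - P 2 1 * (p0 * z 1) + P 2 1 * (P 1 0 * z 0)| ≤
        (1 * 1) * K + C₀ * (1 * K) + C₀ * (1 * K) + C₀ * (C₀ * K) := by
      have := hPe 1 0
      have := hPe 2 0
      have := hPe 2 1
      refine (abs_add_le _ _).trans (add_le_add ((abs_sub _ _).trans
        (add_le_add ((abs_sub _ _).trans (add_le_add ?_ ?_)) ?_)) ?_)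
      all_goals simp only [abs_mul, abs_of_pos p0p, abs_of_pos p1p]
      all_goals gcongr
    have h3 : 1 ≤ c₀ ^ 2 * (p0 * p1 * p2) := by nlinarith
    calc |u 2| = 1 * |u 2| := by ring
      _ ≤ (c₀ ^ 2 * (p0 * p1 * p2)) * |u 2| := by gcongr
      _ = c₀ ^ 2 * |(p0 * p1 * p2) * u 2| := by
        rw [abs_mul, abs_of_pos (mul_pos (mul_pos p0p p1p) p2p)]; ring
      _ ≤ _ := by
        rw [h1]; gcongr
        refine h2.trans ?_
        nlinarith [mul_nonneg hK (sub_nonneg.2 hC₀), mul_nonneg (mul_nonneg hK (sub_nonneg.2 hC₀)) (sub_nonneg.2 hC₀)]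
  have hCC : C₀ ≤ C₀ ^ 2 := by nlinarith
  have hcc : c₀ ≤ c₀ ^ 2 := by nlinarith
  intro i
  fin_cases i
  · refine b0.trans ?_
    calc c₀ * K = (1 * 1) * c₀ * K := by ring
      _ ≤ _ := by gcongr <;> nlinarith
  · refine b1.trans ?_
    calc c₀ * (2 * C₀ * K) = (2 * C₀) * c₀ * K := by ring
      _ ≤ _ := by gcongr <;> nlinarith
  · refine b2.trans (le_of_eq ?_)
    ring

lemma aux_ball_mono {t : ℝ} {x : H3} {r r' : ℝ} (hr : 0 ≤ r) (h : r ≤ r') :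
    ballH α β t x r ⊆ ballH α β t x r' := by
  rintro w ⟨z, h0, h1, h2, rfl⟩
  exact ⟨z, h0.trans h, h1.trans h, h2.trans (by gcongr), rfl⟩

lemma aux_hmul_zero (x : H3) : hmul x 0 = x := by
  ext i
  fin_cases i <;> simp [hmul]

lemma aux_mem_self {t : ℝ} {x : H3} {r : ℝ} (hr : 0 ≤ r) : x ∈ ballH α β t x r := by
  refine ⟨0, by simpa, by simpa, by simpa using sq_nonneg r, ?_⟩
  rw [Matrix.mulVec_zero, aux_hmul_zero]

lemma aux_cont (M : Matrix (Fin 3) (Fin 3) ℝ) (x : H3) :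
    Continuous (fun z : H3 => hmul x (M.mulVec z)) := by
  have h : Continuous (fun z : H3 => M.mulVec z) := by fun_prop
  have h0 := (continuous_apply (0 : Fin 3)).comp h
  have h1 := (continuous_apply (1 : Fin 3)).comp h
  have h2 := (continuous_apply (2 : Fin 3)).comp h
  simp only [Function.comp_def] at h0 h1 h2
  apply continuous_pi
  intro i
  fin_cases i
  · simp only [hmul, Fin.zero_eta, Matrix.cons_val]; exact continuous_const.add h0
  · simp only [hmul, Fin.mk_one, Matrix.cons_val]; exact continuous_const.add h1
  · simp only [hmul, Fin.reduceFinMk, Matrix.cons_val]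
    exact (continuous_const.add h2).add
      (continuous_const.mul ((continuous_const.mul h1).sub (continuous_const.mul h0)))

lemma aux_ball_image (t : ℝ) (x : H3) (r : ℝ) :
    ballH α β t x r = (fun z : H3 => hmul x ((Atil α β t).mulVec z)) ''
      (Icc ![-r, -r, -(r^2)] ![r, r, r^2]) := by
  ext w
  constructor
  · rintro ⟨z, h0, h1, h2, rfl⟩
    refine ⟨z, ?_, rfl⟩
    rw [abs_le] at h0 h1 h2
    constructor <;> intro i <;> fin_cases i <;> simp <;> linarith
  · rintro ⟨z, ⟨ha, hb⟩, rfl⟩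
    have a0 := ha 0
    have a1 := ha 1
    have a2 := ha 2
    have b0 := hb 0
    have b1 := hb 1
    have b2 := hb 2
    simp at a0 a1 a2 b0 b1 b2
    exact ⟨z, abs_le.2 ⟨a0, b0⟩, abs_le.2 ⟨a1, b1⟩, abs_le.2 ⟨a2, b2⟩, rfl⟩

lemma aux_ball_preconn (t : ℝ) (x : H3) (r : ℝ) : IsPreconnected (ballH α β t x r) := by
  rw [aux_ball_image]
  exact ((convex_Icc _ _).isPreconnected).image _ (aux_cont _ _).continuousOn

lemma aux_ball_subset {t : ℝ} {x : H3} {r : ℝ} (hr : 0 ≤ r) {Ω : Set H3} (hΩ : IsOpen Ω)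
    (hx : x ∈ Ω) (h : ∀ y ∈ frontier Ω, y ∉ ballH α β t x r) : ballH α β t x r ⊆ Ω := by
  apply (aux_ball_preconn t x r).subset_of_closure_inter_subset hΩ ⟨x, aux_mem_self hr, hx⟩
  rintro y ⟨hy, hy'⟩
  by_contra hn
  refine h y ?_ hy'
  rw [hΩ.frontier_eq]
  exact ⟨hy, hn⟩

lemma aux_rho_nonneg (t : ℝ) (x y : H3) : 0 ≤ rhoH α β t x y :=
  Real.sSup_nonneg fun _ hr => hr.1.le

lemma aux_rho_le {t : ℝ} {x y : H3} {r : ℝ} (hr : 0 ≤ r) (h : y ∈ ballH α β t x r) :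
    rhoH α β t x y ≤ r := by
  apply Real.sSup_le _ hr
  rintro r' ⟨h0, h1⟩
  by_contra hlt
  push Not at hlt
  exact h1 (aux_ball_mono hr hlt.le h)

lemma aux_bdd (hst : Standing α β) {t : ℝ} (ht : 0 < t) (x y : H3) :
    BddAbove {r : ℝ | 0 < r ∧ y ∉ ballH α β t x r} := by
  obtain ⟨z, hz⟩ := aux_coord' (α := α) (β := β) hst ht x y
  set R := 1 + |z 0| + |z 1| + |z 2|
  have h0 := abs_nonneg (z 0)
  have h1 := abs_nonneg (z 1)
  have h2 := abs_nonneg (z 2)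
  have hR : 1 ≤ R := by simp only [R]; linarith
  have hy : y ∈ ballH α β t x R := by
    refine ⟨z, ?_, ?_, ?_, hz⟩
    · simp only [R]; linarith
    · simp only [R]; linarith
    · have : |z 2| ≤ R := by simp only [R]; linarith
      nlinarith
  refine ⟨R, ?_⟩
  rintro r' ⟨h0, h1⟩
  by_contra hlt
  push Not at hlt
  exact h1 (aux_ball_mono (by linarith) hlt.le hy)

lemma aux_le_rho (hst : Standing α β) {t : ℝ} (ht : 0 < t) {x y : H3} {r : ℝ} (hr : 0 < r)
    (h : y ∉ ballH α β t x r) : r ≤ rhoH α β t x y :=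
  le_csSup (aux_bdd hst ht x y) ⟨hr, h⟩

lemma aux_set_le {t : ℝ} {x y : H3} {r : ℝ} (hr : 0 ≤ r) {S : Set H3} (hy : y ∈ S)
    (h : y ∈ ballH α β t x r) : rhoHSet α β t x S ≤ r :=
  (csInf_le ⟨0, by rintro _ ⟨w, _, rfl⟩; exact aux_rho_nonneg t x w⟩
    (mem_image_of_mem (rhoH α β t x) hy)).trans (aux_rho_le hr h)

lemma aux_not_mem {t : ℝ} {x y : H3} {r : ℝ} (hr : 0 ≤ r) {S : Set H3} (hy : y ∈ S)
    (h : r < rhoHSet α β t x S) : y ∉ ballH α β t x r := fun hb =>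
  absurd (aux_set_le hr hy hb) (not_le.2 h)

lemma aux_exists_near (hst : Standing α β) {t : ℝ} (ht : 0 < t) {x : H3} {r : ℝ} (hr : 0 < r)
    {S : Set H3} (hS : S.Nonempty) (h : rhoHSet α β t x S < r) : ∃ y ∈ S, y ∈ ballH α β t x r := by
  obtain ⟨_, ⟨y, hy, rfl⟩, hlt⟩ := exists_lt_of_csInf_lt (hS.image _) h
  refine ⟨y, hy, ?_⟩
  by_contra hn
  exact absurd (aux_le_rho hst ht hr hn) (not_le.2 hlt)

lemma aux_le_set (hst : Standing α β) {t : ℝ} (ht : 0 < t) {x : H3} {r : ℝ} (hr : 0 < r)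
    {S : Set H3} (hS : S.Nonempty) (h : ∀ y ∈ S, y ∉ ballH α β t x r) :
    r ≤ rhoHSet α β t x S := by
  apply le_csInf (hS.image _)
  rintro _ ⟨y, hy, rfl⟩
  exact aux_le_rho hst ht hr (h y hy)

lemma aux_far (hst : Standing α β) {C₀ ε₀ : ℝ} (hε₀ : 0 < ε₀)
    (hfrob : ∀ t s : ℝ, 0 < t → t ≤ s →
        frob ((Atil α β s)⁻¹ * Atil α β t) ≤ C₀ * (t/s) ^ ε₀)
    {Ω : Set H3} (hΩ : IsOpen Ω) {x : H3} (hx : x ∈ Ω) (hne : (frontier Ω).Nonempty)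
    {R : ℝ} (hR : 1 ≤ R) :
    ∃ τ > 0, ∀ t, 0 < t → t < τ → R ≤ rhoHSet α β t x (frontier Ω) := by
  have hc := (aux_cont (Atil α β 1) x).tendsto 0
  rw [Matrix.mulVec_zero, aux_hmul_zero] at hc
  obtain ⟨δ, hδ, hb⟩ := Metric.mem_nhds_iff.1 (hc (hΩ.mem_nhds hx))
  have hlim : Filter.Tendsto (fun t : ℝ => 2 * (C₀ * (t/1) ^ ε₀) * R^2) (nhds 0) (nhds 0) := by
    have h1 : Continuous (fun t : ℝ => 2 * (C₀ * (t/1) ^ ε₀) * R^2) := by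
      have := Real.continuous_rpow_const hε₀.le
      simp only [div_one]
      fun_prop
    have := h1.tendsto 0
    simpa [Real.zero_rpow hε₀.ne'] using this
  obtain ⟨τ, hτ, hτ'⟩ := Metric.eventually_nhds_iff.1 (hlim.eventually (Iio_mem_nhds hδ))
  refine ⟨min τ 1, lt_min hτ one_pos, ?_⟩
  intro t ht htτ
  apply aux_le_set hst ht (by linarith) hne
  rintro y hy ⟨z, h0, h1, h2, rfl⟩
  have hRR : R ≤ R^2 := by nlinarith
  obtain ⟨u, hu, hu'⟩ := aux_change hst hfrob ht (htτ.le.trans (min_le_right _ _)) (K := R^2) z (by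
    intro i
    fin_cases i
    · exact h0.trans hRR
    · exact h1.trans hRR
    · exact h2)
  rw [hu] at hy
  have hsm := @hτ' t (by rw [Real.dist_eq, sub_zero, abs_of_pos ht]; exact htτ.trans_le (min_le_left _ _))
  have hmem : u ∈ Metric.ball (0 : H3) δ := by
    rw [mem_ball_zero_iff, pi_norm_lt_iff hδ]
    intro i
    exact (hu' i).trans_lt hsm
  have := hb hmem
  rw [hΩ.frontier_eq] at hy
  exact hy.2 this

lemma aux_near (hst : Standing α β) {C₀ ε₀ : ℝ} (hε₀ : 0 < ε₀)
    (hfrob : ∀ t s : ℝ, 0 < t → t ≤ s →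
        frob ((Atil α β s)⁻¹ * Atil α β t) ≤ C₀ * (t/s) ^ ε₀)
    {S : Set H3} (x : H3) (hne : S.Nonempty) :
    ∃ T : ℝ, ∀ s, T ≤ s → rhoHSet α β s x S ≤ 1 := by
  obtain ⟨y, hy⟩ := hne
  obtain ⟨z, hz⟩ := aux_coord' (α := α) (β := β) hst one_pos x y
  have hlim : Filter.Tendsto (fun s : ℝ => 2 * (C₀ * (1/s) ^ ε₀) * ‖z‖) Filter.atTop (nhds 0) := by
    have h1 : Filter.Tendsto (fun s : ℝ => (1/s)^ε₀) Filter.atTop (nhds 0) := by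
      have h2 := (Real.continuous_rpow_const hε₀.le).tendsto 0
      rw [Real.zero_rpow hε₀.ne'] at h2
      have h3 : Filter.Tendsto (fun s : ℝ => 1/s) Filter.atTop (nhds 0) := by
        simpa using tendsto_inv_atTop_zero (𝕜 := ℝ)
      exact h2.comp h3
    simpa using ((h1.const_mul C₀).const_mul 2).mul_const ‖z‖
  obtain ⟨T, hT⟩ := Filter.eventually_atTop.1 (hlim.eventually (Iio_mem_nhds one_pos))
  refine ⟨max T 1, fun s hs => ?_⟩
  obtain ⟨u, hu, hu'⟩ := aux_change hst hfrob one_pos ((le_max_right _ _).trans hs) (K := ‖z‖) z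
    (fun i => norm_le_pi_norm z i)
  have hlt := hT s ((le_max_left _ _).trans hs)
  replace hlt : 2 * (C₀ * (1/s) ^ ε₀) * ‖z‖ < 1 := hlt
  apply aux_set_le zero_le_one hy
  refine ⟨u, (hu' 0).trans hlt.le, (hu' 1).trans hlt.le, ?_, by rw [hz, hu]⟩
  rw [one_pow]
  exact (hu' 2).trans hlt.le

lemma aux_exists_l (hst : Standing α β)
    (tl : ℤ → ℝ) (htl_pos : ∀ l, 0 < tl l)
    (htl_zero : Filter.Tendsto tl Filter.atTop (nhds 0))
    (htl_top : Filter.Tendsto tl Filter.atBot Filter.atTop)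
    (c₀ : ℝ) (hc₀ : 1 ≤ c₀)
    (htl_ratio : ∀ l : ℤ, tl l * h₂ α (tl l) * hbar₃ α β (tl l) ≤
        c₀ * (tl (l+1) * h₂ α (tl (l+1)) * hbar₃ α β (tl (l+1))))
    (C₀ : ℝ) (hC₀ : 1 ≤ C₀) (ε₀ : ℝ) (hε₀ : 0 < ε₀)
    (hfrob : ∀ t s : ℝ, 0 < t → t ≤ s →
        frob ((Atil α β s)⁻¹ * Atil α β t) ≤ C₀ * (t/s) ^ ε₀)
    (A₁ : ℝ) (hA₁ : 4 * c₀ ^ 2 * (2 * C₀ + 1) ^ 4 * (8 * C₀) < A₁)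
    {Ω : Set H3} (hΩ : IsOpen Ω) {x : H3} (hx : x ∈ Ω) (hne : (frontier Ω).Nonempty) :
    ∃ l : ℤ, 8 * C₀ < rhoHSet α β (tl l) x (frontier Ω) ∧
                 rhoHSet α β (tl l) x (frontier Ω) < A₁ := by
  obtain ⟨τ, hτ, hfar⟩ := aux_far hst hε₀ hfrob hΩ hx hne (R := 9 * C₀) (by linarith)
  obtain ⟨T, hT⟩ := aux_near hst hε₀ hfrob x hne
  obtain ⟨l₁, hl₁⟩ := (htl_zero.eventually (Iio_mem_nhds hτ)).exists
  obtain ⟨l₀, hl₀⟩ := Filter.eventually_atBot.1 (htl_top.eventually (Filter.eventually_ge_atTop T))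
  obtain ⟨l, hl, hmin⟩ := Int.exists_least_of_bdd
    (P := fun l => 8 * C₀ < rhoHSet α β (tl l) x (frontier Ω))
    ⟨l₀, fun l hl => by
      by_contra h
      push Not at h
      have := hT _ (hl₀ l h.le)
      linarith⟩
    ⟨l₁, by have := hfar _ (htl_pos l₁) hl₁; linarith⟩
  refine ⟨l, hl, ?_⟩
  have hprev : rhoHSet α β (tl (l-1)) x (frontier Ω) < 9 * C₀ := by
    by_contra h
    push Not at h
    have := hmin (l-1) (by linarith)
    linarith
  obtain ⟨y, hy, z, h0, h1, h2, rfl⟩ := aux_exists_near hst (htl_pos _) (by linarith) hne hprev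
  have hRR : 9 * C₀ ≤ (9 * C₀)^2 := by nlinarith
  have hz : ∀ i, |z i| ≤ (9 * C₀)^2 := by
    intro i
    fin_cases i
    · exact h0.trans hRR
    · exact h1.trans hRR
    · exact h2
  obtain ⟨u, hu, hu'⟩ : ∃ u : H3, (Atil α β (tl (l-1))).mulVec z = (Atil α β (tl l)).mulVec u ∧
      ∀ i, |u i| ≤ 4 * C₀ ^ 2 * c₀ ^ 2 * (9 * C₀)^2 := by
    rcases le_total (tl l) (tl (l-1)) with h | h
    · have hr := htl_ratio (l-1)
      rw [sub_add_cancel] at hr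
      exact aux_back hst hC₀ hc₀ hε₀ hfrob (htl_pos _) h hr z hz
    · obtain ⟨u, hu, hu'⟩ := aux_change hst hfrob (htl_pos _) h z hz
      refine ⟨u, hu, fun i => (hu' i).trans ?_⟩
      have : (tl (l-1) / tl l)^ε₀ ≤ 1 := Real.rpow_le_one
        (div_pos (htl_pos _) (htl_pos _)).le (by rw [div_le_one (htl_pos _)]; exact h) hε₀.le
      have h3 : C₀ * (tl (l-1) / tl l)^ε₀ ≤ C₀ := by nlinarith
      have hc2 : 1 ≤ c₀ ^ 2 := by nlinarith
      have : 2 * (C₀ * (tl (l-1) / tl l)^ε₀) ≤ 4 * C₀ ^ 2 * c₀ ^ 2 := by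
        calc 2 * (C₀ * (tl (l-1) / tl l)^ε₀) ≤ 4 * C₀^2 * 1 := by nlinarith
          _ ≤ _ := by gcongr
      gcongr
  have hbig : 4 * C₀ ^ 2 * c₀ ^ 2 * (9 * C₀)^2 ≤ 4 * c₀ ^ 2 * (2 * C₀ + 1) ^ 4 * (8 * C₀) := by
    have h1 : (2 * C₀)^4 ≤ (2 * C₀ + 1)^4 := by gcongr; linarith
    have h2 : 4 * C₀^2 * (9 * C₀)^2 ≤ 4 * (2 * C₀ + 1) ^ 4 * (8 * C₀) := by
      calc 4 * C₀^2 * (9 * C₀)^2 = 324 * C₀^4 * 1 := by ring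
        _ ≤ 512 * C₀^4 * C₀ := by gcongr; norm_num
        _ = 4 * (2 * C₀)^4 * (8 * C₀) := by ring
        _ ≤ _ := by gcongr
    calc 4 * C₀ ^ 2 * c₀ ^ 2 * (9 * C₀)^2 = c₀^2 * (4 * C₀^2 * (9 * C₀)^2) := by ring
      _ ≤ c₀^2 * (4 * (2 * C₀ + 1) ^ 4 * (8 * C₀)) := by gcongr
      _ = _ := by ring
  set Q := 4 * c₀ ^ 2 * (2 * C₀ + 1) ^ 4 * (8 * C₀) with hQ
  have hQ1 : 1 ≤ Q := by
    refine le_trans ?_ hbig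
    have : 1 ≤ C₀^2 := by nlinarith
    have : 1 ≤ c₀^2 := by nlinarith
    calc (1:ℝ) ≤ 4 * 1 * 1 * 81 := by norm_num
      _ ≤ 4 * C₀^2 * c₀^2 * (9 * C₀)^2 := by gcongr; nlinarith
  refine lt_of_le_of_lt (aux_set_le (r := Q) (by linarith) hy ?_) hA₁
  refine ⟨u, (hu' 0).trans hbig, (hu' 1).trans hbig, ?_, by rw [hu]⟩
  have := (hu' 2).trans hbig
  nlinarith

set_option maxHeartbeats 2000000 in
lemma aux_engulf (hst : Standing α β) {C₀ ε₀ : ℝ} (hC₀ : 1 ≤ C₀) (hε₀ : 0 < ε₀)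
    (hfrob : ∀ t s : ℝ, 0 < t → t ≤ s →
        frob ((Atil α β s)⁻¹ * Atil α β t) ≤ C₀ * (t/s) ^ ε₀) {t s : ℝ} (ht : 0 < t) (hts : t ≤ s)
    {x x' : H3} (hi : (ballH α β t x 1 ∩ ballH α β s x' 1).Nonempty) :
    ballH α β t x 1 ⊆ ballH α β s x' (6 * C₀) := by
  have hs := ht.trans_le hts
  obtain ⟨v, ⟨z₁, a0, a1, a2, hv⟩, ⟨y, b0, b1, b2, hv'⟩⟩ := hi
  rintro w ⟨z, c0, c1, c2, rfl⟩
  have hle : C₀ * (t/s)^ε₀ ≤ C₀ := by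
    have : (t/s)^ε₀ ≤ 1 := Real.rpow_le_one (by positivity) (by rw [div_le_one hs]; exact hts) hε₀.le
    nlinarith
  rw [one_pow] at a2 b2 c2
  obtain ⟨u, hu, hu'⟩ := aux_change hst hfrob ht hts (K := 1) z (by
    intro i; fin_cases i <;> assumption)
  obtain ⟨p, hp, hp'⟩ := aux_change hst hfrob ht hts (K := 1) z₁ (by
    intro i; fin_cases i <;> assumption)
  rw [hp] at hv
  rw [hu]
  have hub : ∀ i, |u i| ≤ 2 * C₀ := fun i => (hu' i).trans (by linarith)
  have hpb : ∀ i, |p i| ≤ 2 * C₀ := fun i => (hp' i).trans (by linarith)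
  have h2 := aux_h2_pos hst hs
  have h3 := aux_h3_pos hst hs
  set D := s * h₂ α s + hbar₃ α β s with hD
  have hDp : 0 < D := by positivity
  set ξ := (s * h₂ α s) / D with hξ
  have hξ0 : 0 ≤ ξ := by positivity
  have hξ1 : ξ ≤ 1 := by rw [hξ, div_le_one hDp]; linarith
  have hξD : D * ξ = s * h₂ α s := by rw [hξ]; field_simp
  set ω := (y 0 * u 1 - y 1 * u 0) - (y 0 * p 1 - y 1 * p 0) - (p 0 * u 1 - p 1 * u 0) with hω
  refine ⟨![y 0 - p 0 + u 0, y 1 - p 1 + u 1, y 2 - p 2 + u 2 + (1/2) * ξ * ω], ?_, ?_, ?_, ?_⟩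
  · have := hub 0
    have := hpb 0
    simp only [Matrix.cons_val]
    rw [abs_le] at *
    constructor <;> linarith
  · have := hub 1
    have := hpb 1
    simp only [Matrix.cons_val]
    rw [abs_le] at *
    constructor <;> linarith
  · have k2 := hub 2
    have l2 := hpb 2
    have k1 := hub 1
    have l1 := hpb 1
    have k0 := hub 0
    have l0 := hpb 0
    simp only [Matrix.cons_val]
    have hωb : |ω| ≤ ((1 * (2 * C₀)) + (1 * (2 * C₀))) + ((1 * (2 * C₀)) + (1 * (2 * C₀))) +
        ((2 * C₀) * (2 * C₀) + (2 * C₀) * (2 * C₀)) := by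
      refine (abs_sub _ _).trans (add_le_add ((abs_sub _ _).trans (add_le_add
        ((abs_sub _ _).trans (add_le_add ?_ ?_)) ((abs_sub _ _).trans (add_le_add ?_ ?_))))
        ((abs_sub _ _).trans (add_le_add ?_ ?_)))
      all_goals rw [abs_mul]; gcongr
    have hξω : |(1/2) * ξ * ω| ≤ (1/2) * 1 * (8 * C₀ + 8 * C₀^2) := by
      rw [abs_mul, abs_of_nonneg (by positivity)]
      gcongr
      linarith
    have hCC : C₀ ≤ C₀ ^ 2 := by nlinarith
    have h36 : (6 * C₀)^2 = 36 * C₀^2 := by ring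
    rw [h36]
    generalize 1 / 2 * ξ * ω = q at hξω
    clear_value ω ξ D
    rw [abs_le] at b2 k2 l2 hξω ⊢
    constructor <;> linarith
  · have key : hmul x ((Atil α β s).mulVec p) = hmul x' ((Atil α β s).mulVec y) := hv.symm.trans hv'
    have e0 := congrFun key 0
    have e1 := congrFun key 1
    have e2 := congrFun key 2
    simp [hmul, Atil, Matrix.mulVec, dotProduct, Fin.sum_univ_three] at e0 e1 e2
    rw [← hD] at e2
    have x0 : x 0 = x' 0 + s * y 0 - s * p 0 := by linarith
    have x1 : x 1 = x' 1 + (α s * y 0 + h₂ α s * y 1) - (α s * p 0 + h₂ α s * p 1) := by linarith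
    have hx2 := eq_sub_of_add_eq e2
    have x2 := eq_sub_of_add_eq hx2
    ext i
    fin_cases i
    · simp [hmul, Atil, Matrix.mulVec, dotProduct, Fin.sum_univ_three]
      rw [x0]; ring
    · simp [hmul, Atil, Matrix.mulVec, dotProduct, Fin.sum_univ_three]
      rw [x1]; ring
    · simp [hmul, Atil, Matrix.mulVec, dotProduct, Fin.sum_univ_three]
      rw [x2, x0, x1, ← hD]
      have : D * (y 2 - p 2 + u 2 + 2⁻¹ * ξ * ω) = D * (y 2 - p 2 + u 2) + 2⁻¹ * (s * h₂ α s) * ω := by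
        rw [← hξD]; ring
      rw [this, hω]
      ring

lemma aux_ball_interior (hst : Standing α β) {t : ℝ} (ht : 0 < t) (x : H3) :
    (interior (ballH α β t x 1)).Nonempty := by
  set f : H3 → H3 := fun y => (Atil α β t)⁻¹.mulVec (hmul (-x) ((1 : Matrix (Fin 3) (Fin 3) ℝ).mulVec y)) with hf
  have hfc : Continuous f := by
    have := aux_cont 1 (-x)
    have h2 : Continuous (fun z : H3 => (Atil α β t)⁻¹.mulVec z) := by fun_prop
    exact h2.comp this
  refine ⟨x, mem_interior.2 ⟨f ⁻¹' (Metric.ball 0 1), ?_, Metric.isOpen_ball.preimage hfc, ?_⟩⟩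
  · intro y hy
    rw [mem_preimage, mem_ball_zero_iff, pi_norm_lt_iff one_pos] at hy
    refine ⟨f y, (hy 0).le, (hy 1).le, by simpa using (hy 2).le, ?_⟩
    rw [hf]
    simp only []
    rw [Matrix.mulVec_mulVec, Matrix.mul_nonsing_inv _
      (isUnit_iff_ne_zero.2 (aux_det_pos hst ht).ne'), Matrix.one_mulVec, Matrix.one_mulVec]
    exact aux_hmul_inv x y
  · have : f x = 0 := by
      have h0 : hmul (-x) x = 0 := by
        ext i
        fin_cases i <;> simp [hmul]
        ring
      rw [hf]
      simp only []
      rw [Matrix.one_mulVec, h0, Matrix.mulVec_zero]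
    rw [mem_preimage, this]
    exact Metric.mem_ball_self one_pos

lemma aux_ball_volume (hst : Standing α β) {t : ℝ} (ht : 0 < t) (x : H3) :
    ENNReal.ofReal ((Atil α β t).det) ≤ volume (ballH α β t x 1) := by
  set L : Matrix (Fin 3) (Fin 3) ℝ := !![1, 0, 0; 0, 1, 0; -(1/2) * x 1, (1/2) * x 0, 1] with hL
  have hLd : L.det = 1 := by simp [hL, Matrix.det_fin_three]
  have hm : ∀ y, hmul x y = x + L.mulVec y := by
    intro y
    ext i
    fin_cases i <;> simp [hmul, hL, Matrix.mulVec, dotProduct, Fin.sum_univ_three]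
    ring
  have himg : ballH α β t x 1 = (fun z => x + z) '' ((Matrix.toLin' (L * Atil α β t)) ''
      (Icc ![-1, -1, -(1^2)] ![1, 1, 1^2])) := by
    rw [aux_ball_image, image_image]
    congr 1
    ext1 z
    rw [hm, Matrix.toLin'_apply, Matrix.mulVec_mulVec]
  rw [himg, image_add_left, measure_preimage_add, Measure.addHaar_image_linearMap,
    LinearMap.det_toLin', Matrix.det_mul, hLd, one_mul, abs_of_pos (aux_det_pos hst ht),
    Real.volume_Icc_pi]
  refine le_mul_of_one_le_right (by simp) ?_
  rw [Fin.prod_univ_three]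
  simp
  norm_num

end aux

/-- The covering lemma: every nonempty open proper subset `Ω` of `H¹` is the
union of the balls of radius `1` whose distance to `∂Ω` lies in `(A₀, A₁)`; if moreover `Ω`
has finite measure, a countable disjoint subfamily dilated by `6C₀` still covers `Ω`. -/
theorem covering_lemma
    (α β : ℝ → ℝ) (hst : Standing α β)
    (tl : ℤ → ℝ) (htl_pos : ∀ l, 0 < tl l)
    (htl_zero : Filter.Tendsto tl Filter.atTop (nhds 0))
    (htl_top : Filter.Tendsto tl Filter.atBot Filter.atTop)
    (c₀ : ℝ) (hc₀ : 1 ≤ c₀)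
    (htl_ratio : ∀ l : ℤ, tl l * h₂ α (tl l) * hbar₃ α β (tl l) ≤
        c₀ * (tl (l+1) * h₂ α (tl (l+1)) * hbar₃ α β (tl (l+1))))
    (C₀ : ℝ) (hC₀ : 1 ≤ C₀) (ε₀ : ℝ) (hε₀ : 0 < ε₀)
    (hfrob : ∀ t s : ℝ, 0 < t → t ≤ s →
        frob ((Atil α β s)⁻¹ * Atil α β t) ≤ C₀ * (t/s) ^ ε₀)
    (A₁ : ℝ) (hA₁ : 4 * c₀ ^ 2 * (2 * C₀ + 1) ^ 4 * (8 * C₀) < A₁)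
    :
    ∀ Ω : Set H3, IsOpen Ω → Ω.Nonempty → Ω ≠ Set.univ →
      (Ω = ⋃ (x : H3) (_ : x ∈ Ω) (l : ℤ)
            (_ : 8 * C₀ < rhoHSet α β (tl l) x (frontier Ω) ∧
                 rhoHSet α β (tl l) x (frontier Ω) < A₁),
            ballH α β (tl l) x 1) ∧
      (volume Ω < ⊤ →
        ∃ s : Set (ℤ × H3), s.Countable ∧
          (∀ q ∈ s, q.2 ∈ Ω ∧ 8 * C₀ < rhoHSet α β (tl q.1) q.2 (frontier Ω) ∧
              rhoHSet α β (tl q.1) q.2 (frontier Ω) < A₁) ∧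
          s.PairwiseDisjoint (fun q => ballH α β (tl q.1) q.2 1) ∧
          Ω = ⋃ q ∈ s, ballH α β (tl q.1) q.2 (6 * C₀)) := by
  intro Ω hΩ hΩne hΩu
  have hne : (frontier Ω).Nonempty := by
    rw [nonempty_frontier_iff]
    exact ⟨hΩne, hΩu⟩
  have hsub : ∀ x ∈ Ω, ∀ l : ℤ, 8 * C₀ < rhoHSet α β (tl l) x (frontier Ω) → ∀ r, 0 ≤ r →
      r ≤ 8 * C₀ → ballH α β (tl l) x r ⊆ Ω := by
    intro x hx l hl r hr hr'
    exact aux_ball_subset hr hΩ hx fun y hy => aux_not_mem hr hy (hr'.trans_lt hl)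
  have hex : ∀ x ∈ Ω, ∃ l : ℤ, 8 * C₀ < rhoHSet α β (tl l) x (frontier Ω) ∧
      rhoHSet α β (tl l) x (frontier Ω) < A₁ := fun x hx =>
    aux_exists_l hst tl htl_pos htl_zero htl_top c₀ hc₀ htl_ratio C₀ hC₀ ε₀ hε₀ hfrob A₁ hA₁ hΩ hx hne
  refine ⟨?_, ?_⟩
  · apply Subset.antisymm
    · intro x hx
      obtain ⟨l, hl⟩ := hex x hx
      simp only [mem_iUnion]
      exact ⟨x, hx, l, hl, aux_mem_self zero_le_one⟩
    · intro w hw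
      simp only [mem_iUnion] at hw
      obtain ⟨x, hx, l, hl, hw⟩ := hw
      exact hsub x hx l hl.1 1 zero_le_one (by linarith) hw
  · intro hV
    set E : Set (ℤ × H3) := {q | q.2 ∈ Ω ∧ 8 * C₀ < rhoHSet α β (tl q.1) q.2 (frontier Ω) ∧
              rhoHSet α β (tl q.1) q.2 (frontier Ω) < A₁} with hE
    -- the scales that occur are bounded
    obtain ⟨T, hT⟩ : ∃ T : ℝ, ∀ q ∈ E, tl q.1 ≤ T := by
      have h21 := aux_h2_pos hst one_pos
      refine ⟨max 1 ((volume Ω).toReal / h₂ α 1 ^ 2), fun q hq => ?_⟩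
      rcases le_total (tl q.1) 1 with h | h
      · exact h.trans (le_max_left _ _)
      · refine le_trans ?_ (le_max_right _ _)
        have h1 := (aux_ball_volume hst (htl_pos q.1) q.2).trans
          (measure_mono (hsub q.2 hq.1 q.1 hq.2.1 1 zero_le_one (by linarith)))
        rw [ENNReal.ofReal_le_iff_le_toReal hV.ne, aux_det] at h1
        have h2 := aux_h2_mono hst one_pos h
        have h3 := aux_h3_pos hst (htl_pos q.1)
        rw [le_div_iff₀ (by positivity)]
        refine le_trans ?_ h1
        have ht := htl_pos q.1
        calc tl q.1 * h₂ α 1 ^ 2 = (tl q.1 * h₂ α 1) * (1 * h₂ α 1) := by ring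
          _ ≤ (tl q.1 * h₂ α (tl q.1)) * (tl q.1 * h₂ α (tl q.1) + hbar₃ α β (tl q.1)) := by
            have h4 : 1 * h₂ α 1 ≤ tl q.1 * h₂ α (tl q.1) := by gcongr
            have h5 : 0 < h₂ α (tl q.1) := aux_h2_pos hst ht
            gcongr
            linarith
    -- rank of a scale
    set F : ℤ → Set ℤ := fun l => {m | tl l < tl m ∧ tl m ≤ T} with hF
    have hfin : ∀ l, (F l).Finite := by
      intro l
      obtain ⟨a, ha⟩ := Filter.eventually_atTop.1 (htl_zero.eventually (Iio_mem_nhds (htl_pos l)))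
      obtain ⟨b, hb⟩ := Filter.eventually_atBot.1
        (htl_top.eventually (Filter.eventually_gt_atTop T))
      apply (Set.finite_Icc b a).subset
      rintro m ⟨h1, h2⟩
      constructor
      · by_contra h
        push Not at h
        exact absurd (hb m h.le) (not_lt.2 h2)
      · by_contra h
        push Not at h
        exact absurd (ha m h.le) (not_lt.2 h1.le)
    have hrank : ∀ l m, tl m ≤ T → tl l < tl m → (F m).ncard < (F l).ncard := by
      intro l m hm hlm
      apply Set.ncard_lt_ncard _ (hfin l)
      refine ⟨fun k hk => ⟨hlm.trans hk.1, hk.2⟩, fun h => ?_⟩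
      have : m ∈ F m := h ⟨hlm, hm⟩
      exact lt_irrefl _ this.1
    obtain ⟨u, huE, hdisj, hcov⟩ := Vitali.exists_disjoint_subfamily_covering_enlargement
      (fun q : ℤ × H3 => ballH α β (tl q.1) q.2 1) E (fun q => (1/2 : ℝ) ^ (F q.1).ncard) (3/2)
      (by norm_num) (fun _ _ => by positivity) 1
      (fun _ _ => pow_le_one₀ (by norm_num) (by norm_num))
      (fun q _ => ⟨q.2, aux_mem_self zero_le_one⟩)
    refine ⟨u, ?_, fun q hq => huE hq, hdisj, ?_⟩
    · exact hdisj.countable_of_nonempty_interior fun q _ => aux_ball_interior hst (htl_pos _) _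
    · apply Subset.antisymm
      · intro x hx
        obtain ⟨l, hl⟩ := hex x hx
        obtain ⟨b, hb, hi, hd⟩ := hcov (l, x) ⟨hx, hl⟩
        have hle : tl l ≤ tl b.1 := by
          by_contra h
          push Not at h
          have h1 := hrank _ _ (hT (l, x) ⟨hx, hl⟩) h
          have h2 : (1/2:ℝ) ^ (F b.1).ncard ≤ (1/2:ℝ) ^ ((F l).ncard + 1) :=
            pow_le_pow_of_le_one (by norm_num) (by norm_num) h1
          have h3 : (0:ℝ) < (1/2:ℝ) ^ (F l).ncard := by positivity
          rw [pow_succ] at h2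
          simp only [] at hd
          linarith
        simp only [mem_iUnion]
        exact ⟨b, hb, aux_engulf hst hC₀ hε₀ hfrob (htl_pos _) hle hi (aux_mem_self zero_le_one)⟩
      · intro w hw
        simp only [mem_iUnion] at hw
        obtain ⟨q, hq, hw⟩ := hw
        exact hsub q.2 (huE hq).1 q.1 (huE hq).2.1 (6 * C₀) (by linarith) (by linarith) hw
end
end

section
/- Under the standing curve hypotheses, for each l∈ℤ the function ρ_l : H¹×H¹ → [0,∞) is a metric: ρ_l(x,y) is finite for all x,y; ρ_l(x,y)=0 if and only if x=y; ρ_l(x,y)=ρ_l(y,x); and ρ_l(x,w) ≤ ρ_l(x,y)+ρ_l(y,w) for all x,y,w∈H¹. -/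
open MeasureTheory Real Set
open scoped ENNReal NNReal

noncomputable section

lemma h2_pos_aux (α β : ℝ → ℝ) (hst : Standing α β) (t : ℝ) (ht : 0 < t) : 0 < h₂ α t := by
  have h0 : α 0 = 0 := by
    have := hst.alpha_odd 0
    simp only [neg_zero] at this
    linarith
  have hdiff : ∀ s, 0 < s → DifferentiableAt ℝ α s := fun s hs =>
    (hst.alpha_c3.differentiableOn (by norm_num)).differentiableAt (Ioi_mem_nhds hs)
  have hd : ∀ s, 0 < s → DifferentiableAt ℝ (deriv α) s := fun s hs =>
    differentiableAt_of_deriv_ne_zero (hst.d2α_pos s hs).ne'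
  have hmono : StrictMonoOn (deriv α) (Ioi 0) := by
    apply strictMonoOn_of_deriv_pos (convex_Ioi 0)
    · intro s hs
      exact (hd s hs).continuousAt.continuousWithinAt
    · intro s hs
      rw [interior_Ioi] at hs
      exact hst.d2α_pos s hs
  obtain ⟨c, hc, hc'⟩ := exists_deriv_eq_slope α ht hst.alpha_cont.continuousOn
    (fun s hs => (hdiff s hs.1).differentiableWithinAt)
  have hlt := hmono hc.1 ht hc.2
  rw [hc', h0, sub_zero, sub_zero, div_lt_iff₀ ht] at hlt
  unfold h₂
  linarith

lemma hbar3_nonneg_aux (α β : ℝ → ℝ) (hst : Standing α β) (t : ℝ) (ht : 0 < t) :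
    0 ≤ hbar₃ α β t := by
  obtain ⟨c, hc, h⟩ := hst.growth
  refine le_trans ?_ (h t ht).2.2
  refine mul_nonneg hc.le (intervalIntegral.integral_nonneg ht.le ?_)
  intro u hu
  rcases eq_or_lt_of_le hu.1 with h | h
  · have := hst.alpha_odd 0
    simp only [neg_zero] at this
    subst h
    unfold h₂
    linarith
  · exact (h2_pos_aux α β hst u h).le

/-- coordinates of `x⁻¹ y` in the basis given by the matrix -/
def zc0 (t : ℝ) (x y : H3) : ℝ := (y 0 - x 0) / t

def zc1 (t a h : ℝ) (x y : H3) : ℝ := (y 1 - x 1 - a * zc0 t x y) / h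

def zc2 (t a h b k D : ℝ) (x y : H3) : ℝ :=
  (y 2 - x 2 - (1/2) * (x 0 * y 1 - x 1 * y 0) - b * zc0 t x y - k * zc1 t a h x y) / D

def Nc (t a h b k D : ℝ) (x y : H3) : ℝ :=
  max |zc0 t x y| (max |zc1 t a h x y| (√|zc2 t a h b k D x y|))

lemma Nc_le_iff (t a h b k D : ℝ) (x y : H3) (r : ℝ) (hr : 0 ≤ r) :
    Nc t a h b k D x y ≤ r ↔
      |zc0 t x y| ≤ r ∧ |zc1 t a h x y| ≤ r ∧ |zc2 t a h b k D x y| ≤ r ^ 2 := by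
  unfold Nc
  rw [max_le_iff, max_le_iff, Real.sqrt_le_left hr]

lemma Nc_nonneg (t a h b k D : ℝ) (x y : H3) : 0 ≤ Nc t a h b k D x y :=
  le_max_of_le_left (abs_nonneg _)

lemma Nc_eq_zero_iff (t a h b k D : ℝ) (ht : 0 < t) (hh : 0 < h) (hD : 0 < D) (x y : H3) :
    Nc t a h b k D x y = 0 ↔ x = y := by
  constructor
  · intro hN
    obtain ⟨e0, e1, e2⟩ := (Nc_le_iff t a h b k D x y 0 le_rfl).1 hN.le
    have e0 := abs_nonpos_iff.1 e0
    have e1 := abs_nonpos_iff.1 e1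
    have e2 : zc2 t a h b k D x y = 0 := abs_nonpos_iff.1 (by simpa using e2)
    unfold zc2 at e2
    rw [e0, e1] at e2
    unfold zc1 at e1
    rw [e0] at e1
    unfold zc0 at e0
    have f0 : y 0 = x 0 := by
      have := (div_eq_zero_iff.1 e0).resolve_right ht.ne'
      linarith
    have f1 : y 1 = x 1 := by
      have := (div_eq_zero_iff.1 e1).resolve_right hh.ne'
      linarith
    have f2 : y 2 = x 2 := by
      have := (div_eq_zero_iff.1 e2).resolve_right hD.ne'
      rw [f0, f1] at this
      linarith
    ext i
    fin_cases i
    · exact f0.symm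
    · exact f1.symm
    · exact f2.symm
  · rintro rfl
    have : x 0 * x 1 - x 1 * x 0 = 0 := by ring
    simp [Nc, zc2, zc1, zc0, this]

lemma Nc_symm (t a h b k D : ℝ) (x y : H3) :
    Nc t a h b k D x y = Nc t a h b k D y x := by
  have e0 : zc0 t x y = - zc0 t y x := by unfold zc0; ring
  have e1 : zc1 t a h x y = - zc1 t a h y x := by unfold zc1; rw [e0]; ring
  have e2 : zc2 t a h b k D x y = - zc2 t a h b k D y x := by unfold zc2; rw [e0, e1]; ring
  unfold Nc
  rw [e0, e1, e2, abs_neg, abs_neg, abs_neg]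

lemma Nc_triangle (t a h b k D : ℝ) (ht : 0 < t) (hh : 0 < h) (hD : t * h ≤ D) (x y w : H3) :
    Nc t a h b k D x w ≤ Nc t a h b k D x y + Nc t a h b k D y w := by
  have hD0 : 0 < D := lt_of_lt_of_le (mul_pos ht hh) hD
  have hr := Nc_nonneg t a h b k D x y
  have hs := Nc_nonneg t a h b k D y w
  obtain ⟨a0, a1, a2⟩ := (Nc_le_iff t a h b k D x y _ hr).1 le_rfl
  obtain ⟨b0, b1, b2⟩ := (Nc_le_iff t a h b k D y w _ hs).1 le_rfl
  set r := Nc t a h b k D x y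
  set s := Nc t a h b k D y w
  have e0 : zc0 t x w = zc0 t x y + zc0 t y w := by unfold zc0; ring
  have e1 : zc1 t a h x w = zc1 t a h x y + zc1 t a h y w := by unfold zc1; rw [e0]; ring
  have e2 : zc2 t a h b k D x w = zc2 t a h b k D x y + zc2 t a h b k D y w
      + (1/2) * (t * h / D) * (zc0 t x y * zc1 t a h y w - zc1 t a h x y * zc0 t y w) := by
    unfold zc2
    rw [e0, e1]
    unfold zc1 zc0
    field_simp
    ring
  have hq0 : 0 ≤ t * h / D := by positivity
  have hq1 : t * h / D ≤ 1 := (div_le_one hD0).2 hD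
  have p1 : |zc0 t x y * zc1 t a h y w| ≤ r * s := by
    rw [abs_mul]; exact mul_le_mul a0 b1 (abs_nonneg _) hr
  have p2 : |zc1 t a h x y * zc0 t y w| ≤ r * s := by
    rw [abs_mul]; exact mul_le_mul a1 b0 (abs_nonneg _) hr
  have p3 : |(1/2) * (t * h / D) * (zc0 t x y * zc1 t a h y w - zc1 t a h x y * zc0 t y w)|
      ≤ r * s := by
    rw [abs_mul, abs_of_nonneg (by positivity : 0 ≤ (1/2) * (t * h / D))]
    have := (abs_sub _ _).trans (add_le_add p1 p2)
    calc _ ≤ (1/2) * 1 * (r * s + r * s) := by gcongr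
      _ = r * s := by ring
  refine (Nc_le_iff t a h b k D x w _ (add_nonneg hr hs)).2 ⟨?_, ?_, ?_⟩
  · rw [e0]; exact (abs_add_le _ _).trans (add_le_add a0 b0)
  · rw [e1]; exact (abs_add_le _ _).trans (add_le_add a1 b1)
  · rw [e2]
    refine (abs_add_three _ _ _).trans ?_
    nlinarith [mul_nonneg hr hs]

/-- the scale-`t` gauge -/
def Nt (α β : ℝ → ℝ) (t : ℝ) (x y : H3) : ℝ :=
  Nc t (α t) (h₂ α t) (βbar α β t) (hβbar α β t) (t * h₂ α t + hbar₃ α β t) x y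

lemma mem_ballH_iff (α β : ℝ → ℝ) (t : ℝ) (ht : 0 < t) (hh : 0 < h₂ α t)
    (hD : 0 < t * h₂ α t + hbar₃ α β t) (x y : H3) (r : ℝ) (hr : 0 ≤ r) :
    y ∈ ballH α β t x r ↔ Nt α β t x y ≤ r := by
  unfold Nt
  rw [Nc_le_iff _ _ _ _ _ _ _ _ _ hr]
  unfold ballH Atil
  generalize α t = a at *
  generalize h₂ α t = h at *
  generalize βbar α β t = b at *
  generalize hβbar α β t = k at *
  generalize t * h + hbar₃ α β t = D at *
  constructor
  · rintro ⟨z, h0, h1, h2, rfl⟩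
    have e0 : ∀ y : H3, y = hmul x (!![t, 0, 0; a, h, 0; b, k, D].mulVec z) →
        y 0 = x 0 + t * z 0 ∧ y 1 = x 1 + (a * z 0 + h * z 1) ∧
        y 2 = x 2 + (b * z 0 + k * z 1 + D * z 2)
          + (1/2) * (x 0 * (a * z 0 + h * z 1) - x 1 * (t * z 0)) := by
      rintro y rfl
      simp [hmul, Matrix.mulVec, dotProduct, Fin.sum_univ_three]
    obtain ⟨f0, f1, f2⟩ := e0 _ rfl
    generalize hmul x (!![t, 0, 0; a, h, 0; b, k, D].mulVec z) = y at *
    have g0 : zc0 t x y = z 0 := by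
      unfold zc0; rw [f0]; field_simp; ring
    have g1 : zc1 t a h x y = z 1 := by
      unfold zc1; rw [g0, f1]; field_simp; ring
    have g2 : zc2 t a h b k D x y = z 2 := by
      unfold zc2; rw [g0, g1, f2, f1, f0]; field_simp; ring
    rw [g0, g1, g2]
    exact ⟨h0, h1, h2⟩
  · rintro ⟨h0, h1, h2⟩
    refine ⟨![zc0 t x y, zc1 t a h x y, zc2 t a h b k D x y], h0, h1, h2, ?_⟩
    have f0 : t * zc0 t x y = y 0 - x 0 := by unfold zc0; field_simp
    have f1 : h * zc1 t a h x y = y 1 - x 1 - a * zc0 t x y := by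
      conv_lhs => unfold zc1
      field_simp
    have f2 : D * zc2 t a h b k D x y = y 2 - x 2 - (1/2) * (x 0 * y 1 - x 1 * y 0)
        - b * zc0 t x y - k * zc1 t a h x y := by
      conv_lhs => unfold zc2
      field_simp
    ext i
    fin_cases i
    · simp [hmul, Matrix.mulVec, dotProduct, Fin.sum_univ_three, f0]
    · simp [hmul, Matrix.mulVec, dotProduct, Fin.sum_univ_three, f1]
    · simp [hmul, Matrix.mulVec, dotProduct, Fin.sum_univ_three, f0, f1, f2]
      ring

lemma ballSet_eq (α β : ℝ → ℝ) (t : ℝ) (ht : 0 < t) (hh : 0 < h₂ α t)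
    (hD : 0 < t * h₂ α t + hbar₃ α β t) (x y : H3) :
    {r : ℝ | 0 < r ∧ y ∉ ballH α β t x r} = Ioo 0 (Nt α β t x y) := by
  ext r
  simp only [mem_setOf_eq, mem_Ioo]
  refine and_congr_right fun hr => ?_
  rw [mem_ballH_iff α β t ht hh hD x y r hr.le, not_le]

lemma rhoH_eq (α β : ℝ → ℝ) (t : ℝ) (ht : 0 < t) (hh : 0 < h₂ α t)
    (hD : 0 < t * h₂ α t + hbar₃ α β t) (x y : H3) :
    rhoH α β t x y = Nt α β t x y := by
  unfold rhoH
  rw [ballSet_eq α β t ht hh hD x y]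
  rcases eq_or_lt_of_le (show 0 ≤ Nt α β t x y from Nc_nonneg _ _ _ _ _ _ _ _) with h | h
  · rw [← h]; simp
  · exact csSup_Ioo h

/-- For each `l`, `ρ_l` is a (finite-valued) metric on `H¹`. -/
theorem rho_is_metric
    (α β : ℝ → ℝ) (hst : Standing α β)
    (tl : ℤ → ℝ) (htl_pos : ∀ l, 0 < tl l)
    (htl_zero : Filter.Tendsto tl Filter.atTop (nhds 0))
    (htl_top : Filter.Tendsto tl Filter.atBot Filter.atTop) :
    ∀ l : ℤ, ∀ x y w : H3,
      BddAbove {r : ℝ | 0 < r ∧ y ∉ ballH α β (tl l) x r} ∧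
      0 ≤ rhoH α β (tl l) x y ∧
      (rhoH α β (tl l) x y = 0 ↔ x = y) ∧
      rhoH α β (tl l) x y = rhoH α β (tl l) y x ∧
      rhoH α β (tl l) x w ≤ rhoH α β (tl l) x y + rhoH α β (tl l) y w := by
  intro l x y w
  have ht := htl_pos l
  have hh := h2_pos_aux α β hst _ ht
  have h3 := hbar3_nonneg_aux α β hst _ ht
  have hD : 0 < tl l * h₂ α (tl l) + hbar₃ α β (tl l) := by positivity
  rw [ballSet_eq α β _ ht hh hD, rhoH_eq α β _ ht hh hD, rhoH_eq α β _ ht hh hD,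
    rhoH_eq α β _ ht hh hD, rhoH_eq α β _ ht hh hD]
  exact ⟨bddAbove_Ioo, Nc_nonneg _ _ _ _ _ _ _ _, Nc_eq_zero_iff _ _ _ _ _ _ ht hh hD x y,
    Nc_symm _ _ _ _ _ _ x y, Nc_triangle _ _ _ _ _ _ ht hh (by linarith) x y w⟩
end
end
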